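/- arXiv:1504.08004 — 2 statements merged into one kernel-verified Lean document; each statement's English description precedes it below -/
import Mathlib

section
/- Fix positive integers g and n, and let p be a complex polynomial in 2gn² commuting variables, viewed as a function of pairs (A,B) of g-tuples of n×n complex matrices via their entries. If p(A, A*) = 0 for every g-tuple A of n×n complex matrices satisfying Σ_{k=1}^g A_kA_kᴴ = I_n (where A* denotes the tuple of conjugate transposes A_kᴴ), then p(A,B) = 0 for every pair (A,B) of g-tuples of n×n complex matrices satisfying Σ_{k=1}^g A_kB_k = I_n. (In other words, the real points X(g,n)_J are Zariski dense in the variety X(g,n).) -/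
open Matrix

noncomputable section

/-- Index set for the `2gn²` commuting variables: `Sum.inl (k, i, j)` is the `(i,j)`
entry of `A_k`, and `Sum.inr (k, i, j)` is the `(i,j)` entry of `B_k`. -/
abbrev Idx (g n : ℕ) := (Fin g × Fin n × Fin n) ⊕ (Fin g × Fin n × Fin n)

/-- Evaluation of a commutative polynomial in the `2gn²` matrix entries at a pair
`(A, B)` of `g`-tuples of `n × n` complex matrices. -/
def evalAt {g n : ℕ} (A B : Fin g → Matrix (Fin n) (Fin n) ℂ)
    (p : MvPolynomial (Idx g n) ℂ) : ℂ :=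
  MvPolynomial.eval
    (Sum.elim (fun x => A x.1 x.2.1 x.2.2) (fun x => B x.1 x.2.1 x.2.2)) p

/-- The diagonal matrix with entries `exp (w * h i)`. -/
def expDiag {m : Type*} [DecidableEq m] (h : m → ℝ) (w : ℂ) : Matrix m m ℂ :=
  diagonal fun i => Complex.exp (w * h i)

theorem conjTranspose_expDiag {m : Type*} [DecidableEq m] (h : m → ℝ) (w : ℂ) :
    (expDiag h w)ᴴ = expDiag h (starRingEnd ℂ w) := by
  simp [expDiag, diagonal_conjTranspose, ← Complex.exp_conj, Pi.star_def]

section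

variable {m N : Type*} [Fintype m] [DecidableEq m] [Fintype N]

theorem expDiag_mul_neg (h : m → ℝ) (w : ℂ) : expDiag h w * expDiag h (-w) = 1 := by
  simp [expDiag, diagonal_mul_diagonal, ← Complex.exp_add]

theorem expDiag_neg_mul (h : m → ℝ) (w : ℂ) : expDiag h (-w) * expDiag h w = 1 := by
  simp [expDiag, diagonal_mul_diagonal, ← Complex.exp_add]

open scoped ComplexOrder in
/-- Singular value decomposition of a left-invertible matrix. -/
theorem exists_svd_of_left_inverse (L : Matrix m N ℂ) (M : Matrix N m ℂ) (hL : L * M = 1) :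
    ∃ (W : Matrix N m ℂ) (V : Matrix m m ℂ) (h : m → ℝ),
      Wᴴ * W = 1 ∧ V * Vᴴ = 1 ∧ M = W * expDiag h 1 * Vᴴ := by
  have hinj : Function.Injective M.mulVec := fun x y hxy => by
    simpa [mulVec_mulVec, hL] using congrArg L.mulVec hxy
  have hpos : (Mᴴ * M).PosDef := PosDef.conjTranspose_mul_self M hinj
  let V : Matrix m m ℂ := hpos.1.eigenvectorUnitary.1
  have hVV : V * Vᴴ = 1 := Unitary.coe_mul_star_self hpos.1.eigenvectorUnitary
  let h : m → ℝ := fun i => Real.log (hpos.1.eigenvalues i) / 2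
  have hdiag : Vᴴ * (Mᴴ * M) * V = expDiag h 1 * expDiag h 1 := by
    have key := hpos.1.conjStarAlgAut_star_eigenvectorUnitary
    rw [Unitary.conjStarAlgAut_star_apply] at key
    refine Eq.trans key ?_
    rw [expDiag, diagonal_mul_diagonal]
    congr 1
    funext i
    rw [← Complex.exp_add, one_mul, ← Complex.ofReal_add, add_halves, ← Complex.ofReal_exp,
      Real.exp_log (hpos.eigenvalues_pos i)]
    rfl
  refine ⟨M * V * expDiag h (-1), V, h, ?_, hVV, ?_⟩
  · calc (M * V * expDiag h (-1))ᴴ * (M * V * expDiag h (-1))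
        = expDiag h (-1) * (Vᴴ * (Mᴴ * M) * V) * expDiag h (-1) := by
          simp [conjTranspose_expDiag, Matrix.mul_assoc]
      _ = (expDiag h (-1) * expDiag h 1) * (expDiag h 1 * expDiag h (-1)) := by
          rw [hdiag]; simp only [Matrix.mul_assoc]
      _ = 1 := by rw [expDiag_neg_mul, expDiag_mul_neg, Matrix.one_mul]
  · calc M = M * (V * Vᴴ) := by rw [hVV, Matrix.mul_one]
      _ = M * V * (expDiag h (-1) * expDiag h 1) * Vᴴ := by
          rw [expDiag_neg_mul, Matrix.mul_one, Matrix.mul_assoc]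
      _ = _ := by simp only [Matrix.mul_assoc]

/-- Every pair with `R * C = 1` lies in the general linear orbit of a pair `(Qᴴ, Q)` with
`Qᴴ * Q = 1`. -/
theorem exists_isometry_orbit [DecidableEq N] (R : Matrix m N ℂ) (C : Matrix N m ℂ) (hRC : R * C = 1) :
    ∃ (Q : Matrix N m ℂ) (S T : Matrix N N ℂ),
      Qᴴ * Q = 1 ∧ T * S = 1 ∧ R = Qᴴ * T ∧ C = S * Q := by
  obtain ⟨Q, V, h, hQ, hV, hC⟩ := exists_svd_of_left_inverse R C hRC
  have hV' : Vᴴ * V = 1 := mul_eq_one_comm.mp hV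
  have hQC : Q = C * (V * expDiag h (-1)) := by
    calc Q = Q * (expDiag h 1 * expDiag h (-1)) := by rw [expDiag_mul_neg, Matrix.mul_one]
      _ = Q * expDiag h 1 * (Vᴴ * V) * expDiag h (-1) := by
          rw [hV', Matrix.mul_one, Matrix.mul_assoc]
      _ = C * (V * expDiag h (-1)) := by rw [hC]; simp only [Matrix.mul_assoc]
  have hker : (1 - C * R) * C = 0 := by
    rw [Matrix.sub_mul, Matrix.one_mul, Matrix.mul_assoc, hRC, Matrix.mul_one, sub_self]
  have hkerQ : (1 - C * R) * Q = 0 := by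
    rw [hQC, ← Matrix.mul_assoc, hker, Matrix.zero_mul]
  have hRker : R * (1 - C * R) = 0 := by
    rw [Matrix.mul_sub, Matrix.mul_one, ← Matrix.mul_assoc, hRC, Matrix.one_mul, sub_self]
  have hQker : Qᴴ * (1 - Q * Qᴴ) = 0 := by
    rw [Matrix.mul_sub, Matrix.mul_one, ← Matrix.mul_assoc, hQ, Matrix.one_mul, sub_self]
  have hkerQ' : (1 - Q * Qᴴ) * Q = 0 := by
    rw [Matrix.sub_mul, Matrix.one_mul, Matrix.mul_assoc, hQ, Matrix.mul_one, sub_self]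
  refine ⟨Q, C * Qᴴ + (1 - C * R) * (1 - Q * Qᴴ), Q * R + (1 - Q * Qᴴ) * (1 - C * R),
    hQ, mul_eq_one_comm.mp ?_, ?_, ?_⟩
  · calc (C * Qᴴ + (1 - C * R) * (1 - Q * Qᴴ)) * (Q * R + (1 - Q * Qᴴ) * (1 - C * R))
        = C * (Qᴴ * Q) * R + C * (Qᴴ * (1 - Q * Qᴴ)) * (1 - C * R)
          + (1 - C * R) * ((1 - Q * Qᴴ) * Q) * R
          + (1 - C * R) * ((1 - Q * Qᴴ) * (1 - Q * Qᴴ)) * (1 - C * R) := by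
          simp only [Matrix.add_mul, Matrix.mul_add, Matrix.mul_assoc, add_assoc]
          abel
      _ = C * R + (1 - C * R) * (1 - Q * Qᴴ) * (1 - C * R) := by
          have : (1 - Q * Qᴴ) * (1 - Q * Qᴴ) = 1 - Q * Qᴴ := by
            rw [Matrix.mul_sub (1 - Q * Qᴴ), ← Matrix.mul_assoc, hkerQ']; simp
          rw [hQ, hQker, hkerQ', this]; simp
      _ = C * R + (1 - C * R) * (1 - C * R) := by
          rw [Matrix.mul_sub (1 - C * R) 1, ← Matrix.mul_assoc (1 - C * R) Q, hkerQ]; simp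
      _ = 1 := by
          rw [Matrix.mul_sub (1 - C * R), ← Matrix.mul_assoc (1 - C * R) C, hker]; simp
  · rw [Matrix.mul_add, ← Matrix.mul_assoc, hQ, ← Matrix.mul_assoc, hQker]; simp
  · rw [Matrix.add_mul, Matrix.mul_assoc, hQ, Matrix.mul_assoc (1 - C * R), hkerQ']; simp

end

theorem differentiable_mvPolynomial_eval {σ : Type*} (p : MvPolynomial σ ℂ) (v : ℂ → σ → ℂ)
    (hv : ∀ s, Differentiable ℂ fun w => v w s) :
    Differentiable ℂ fun w => MvPolynomial.eval (v w) p := by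
  induction p using MvPolynomial.induction_on with
  | C a => simp
  | add p q hp hq => simp only [map_add]; exact hp.add hq
  | mul_X p s hp => simp only [map_mul, MvPolynomial.eval_X]; exact hp.mul (hv s)

theorem differentiable_mul_expDiag_mul_apply {m l r : Type*} [Fintype m] [DecidableEq m]
    (P : Matrix l m ℂ) (P' : Matrix m r ℂ) (h : m → ℝ) (u : ℂ → ℂ) (hu : Differentiable ℂ u)
    (i : l) (j : r) :
    Differentiable ℂ fun w => (P * expDiag h (u w) * P') i j := by
  simp only [expDiag, Matrix.mul_apply (N := P'), Matrix.mul_diagonal]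
  fun_prop

/-- An entire function vanishing on the imaginary axis is zero. -/
theorem eq_zero_of_eq_zero_on_imaginary_axis {f : ℂ → ℂ} (hf : Differentiable ℂ f)
    (h : ∀ w, starRingEnd ℂ w = -w → f w = 0) (w : ℂ) : f w = 0 := by
  have han : AnalyticOnNhd ℂ f Set.univ := fun z _ => hf.analyticAt z
  have htend : Filter.Tendsto (fun t : ℝ => (t : ℂ) * Complex.I)
      (nhdsWithin 0 {0}ᶜ) (nhdsWithin 0 {0}ᶜ) := by
    refine tendsto_nhdsWithin_iff.mpr ⟨?_, ?_⟩
    · have : Continuous fun t : ℝ => (t : ℂ) * Complex.I := by fun_prop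
      simpa using (this.tendsto 0).mono_left nhdsWithin_le_nhds
    · filter_upwards [self_mem_nhdsWithin] with t ht
      simpa using ht
  have hfreq : ∃ᶠ z in nhdsWithin (0 : ℂ) {0}ᶜ, f z = 0 :=
    htend.frequently (Filter.Frequently.of_forall fun t => h _ (by simp))
  exact congrFun (han.eq_of_frequently_eq (g := 0) analyticOnNhd_const hfreq) w

/-- **Zariski density of the real points of `X(g,n)`.**
If a polynomial in the `2gn²` matrix entries vanishes at `(A, A*)` for every `g`-tuple
`A` with `Σ_k A_k A_kᴴ = I_n`, then it vanishes at every pair `(A, B)` with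
`Σ_k A_k B_k = I_n`. -/
theorem real_points_zariski_dense (g n : ℕ) (hg : 0 < g) (hn : 0 < n)
    (p : MvPolynomial (Idx g n) ℂ)
    (hvan : ∀ A : Fin g → Matrix (Fin n) (Fin n) ℂ,
      (∑ k, A k * (A k)ᴴ) = 1 → evalAt A (fun k => (A k)ᴴ) p = 0) :
    ∀ A B : Fin g → Matrix (Fin n) (Fin n) ℂ,
      (∑ k, A k * B k) = 1 → evalAt A B p = 0 := by
  intro A B hAB
  let blockR (R : Matrix (Fin n) (Fin g × Fin n) ℂ) (k : Fin g) : Matrix (Fin n) (Fin n) ℂ :=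
    of fun i j => R i (k, j)
  let blockC (C : Matrix (Fin g × Fin n) (Fin n) ℂ) (k : Fin g) : Matrix (Fin n) (Fin n) ℂ :=
    of fun i j => C (k, i) j
  have hblock (R : Matrix (Fin n) (Fin g × Fin n) ℂ) (C : Matrix (Fin g × Fin n) (Fin n) ℂ) :
      ∑ k, blockR R k * blockC C k = R * C := by
    ext i j
    simp [blockR, blockC, Matrix.sum_apply, Matrix.mul_apply, Fintype.sum_prod_type]
  let R : Matrix (Fin n) (Fin g × Fin n) ℂ := of fun i x => A x.1 i x.2
  let C : Matrix (Fin g × Fin n) (Fin n) ℂ := of fun x j => B x.1 x.2 j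
  have hRC : R * C = 1 := (hblock R C).symm.trans hAB
  obtain ⟨Q, S, T, hQ, hTS, hR, hC⟩ := exists_isometry_orbit R C hRC
  obtain ⟨W, V, h, hW, hV, hS⟩ := exists_svd_of_left_inverse T S hTS
  have hW' : W * Wᴴ = 1 := mul_eq_one_comm.mp hW
  have hT : T = V * expDiag h (-1) * Wᴴ := by
    refine left_inv_eq_right_inv hTS ?_
    calc S * (V * expDiag h (-1) * Wᴴ)
        = W * (expDiag h 1 * (Vᴴ * V) * expDiag h (-1)) * Wᴴ := by
          rw [hS]; simp only [Matrix.mul_assoc]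
      _ = 1 := by
          rw [mul_eq_one_comm.mp hV, Matrix.mul_one, expDiag_mul_neg, Matrix.mul_one, hW']
  have hzero := eq_zero_of_eq_zero_on_imaginary_axis
    (f := fun w => evalAt (blockR (Qᴴ * V * expDiag h (-w) * Wᴴ))
      (blockC (W * expDiag h w * (Vᴴ * Q))) p) ?_ ?_ 1
  · have e₁ : Qᴴ * V * expDiag h (-1) * Wᴴ = R := by rw [hR, hT]; simp only [Matrix.mul_assoc]
    have e₂ : W * expDiag h 1 * (Vᴴ * Q) = C := by rw [hC, hS]; simp only [Matrix.mul_assoc]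
    rw [e₁, e₂] at hzero
    exact hzero
  · refine differentiable_mvPolynomial_eval p _ ?_
    rintro (⟨k, i, j⟩ | ⟨k, i, j⟩)
    · exact differentiable_mul_expDiag_mul_apply _ _ h _ differentiable_neg i (k, j)
    · exact differentiable_mul_expDiag_mul_apply _ _ h _ differentiable_id (k, i) j
  · intro w hw
    have hstar : W * expDiag h w * (Vᴴ * Q) = (Qᴴ * V * expDiag h (-w) * Wᴴ)ᴴ := by
      simp [conjTranspose_expDiag, hw, Matrix.mul_assoc]
    have hreal : (fun k => (blockR (Qᴴ * V * expDiag h (-w) * Wᴴ) k)ᴴ)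
        = blockC (W * expDiag h w * (Vᴴ * Q)) := by
      rw [hstar]; rfl
    have hone : Qᴴ * V * expDiag h (-w) * Wᴴ * (W * expDiag h w * (Vᴴ * Q)) = 1 := by
      calc _ = Qᴴ * (V * (expDiag h (-w) * (Wᴴ * W) * expDiag h w) * Vᴴ) * Q := by
            simp only [Matrix.mul_assoc]
        _ = 1 := by
            rw [hW, Matrix.mul_one, expDiag_neg_mul, Matrix.mul_one, hV, Matrix.mul_one, hQ]
    have := hvan (blockR (Qᴴ * V * expDiag h (-w) * Wᴴ)) (by
      simp only [congrFun hreal]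
      rw [hblock, hone])
    rwa [hreal] at this
end
end

section
/- Fix positive integers g and n. The vanishing ideal of the set X(g,n) = {(A,B) : A, B are g-tuples of n×n complex matrices with Σ_{k=1}^g A_kB_k = I_n}, i.e., the ideal of all complex polynomials in the 2gn² matrix entries that vanish at every point of X(g,n), is a prime ideal of the polynomial ring. (Equivalently, the variety X(g,n) is irreducible.) -/
open Matrix

noncomputable section

/-- The vanishing ideal of `X(g,n) = {(A,B) : Σ_k A_k B_k = I_n}`: all polynomials in the
matrix entries vanishing at every point of `X(g,n)`. -/
def vanishingIdeal (g n : ℕ) : Ideal (MvPolynomial (Idx g n) ℂ) where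
  carrier := {p | ∀ A B : Fin g → Matrix (Fin n) (Fin n) ℂ,
    (∑ k, A k * B k) = 1 → evalAt A B p = 0}
  zero_mem' := by intro A B _; simp [evalAt]
  add_mem' := by
    intro p q hp hq A B h
    simp only [evalAt, map_add] at *
    rw [hp A B h, hq A B h, add_zero]
  smul_mem' := by
    intro c p hp A B h
    simp only [evalAt, smul_eq_mul, _root_.map_mul] at *
    rw [hp A B h, mul_zero]

/-- Clearing denominators: after substituting fractions `u i / d` into a polynomial `p`, a power of
the common denominator `d` makes the result a polynomial. -/
theorem exists_eval_eq_pow_mul_eval_div {σ τ K : Type*} [Field K] (u : σ → MvPolynomial τ K)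
    (d : MvPolynomial τ K) (p : MvPolynomial σ K) :
    ∃ (P : MvPolynomial τ K) (N : ℕ), ∀ v : τ → K, MvPolynomial.eval v d ≠ 0 →
      MvPolynomial.eval v P = MvPolynomial.eval v d ^ N *
        MvPolynomial.eval (fun i => MvPolynomial.eval v (u i) / MvPolynomial.eval v d) p := by
  induction p using MvPolynomial.induction_on with
  | C a => exact ⟨MvPolynomial.C a, 0, fun v _ => by simp⟩
  | add p q hp hq =>
    obtain ⟨P, N, hP⟩ := hp
    obtain ⟨Q, M, hQ⟩ := hq
    refine ⟨d ^ M * P + d ^ N * Q, N + M, fun v hv => ?_⟩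
    simp only [map_add, _root_.map_mul, map_pow, hP v hv, hQ v hv]
    ring
  | mul_X p i hp =>
    obtain ⟨P, N, hP⟩ := hp
    refine ⟨P * u i, N + 1, fun v hv => ?_⟩
    simp only [_root_.map_mul, hP v hv, MvPolynomial.eval_X]
    field_simp
    ring

/-- The generic matrix `Σ_k A_k B_k`, whose entries are polynomials in the entries of `A`, `B`. -/
def genericSum (g n : ℕ) : Matrix (Fin n) (Fin n) (MvPolynomial (Idx g n) ℂ) :=
  ∑ k, Matrix.of (fun i j => MvPolynomial.X (Sum.inl (k, i, j))) *
    Matrix.of (fun i j => MvPolynomial.X (Sum.inr (k, i, j)))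

/-- The numerators, over the denominator `det S` with `S = Σ_k A_k B_k`, of the rational
parametrization `(A, B) ↦ (A, B S⁻¹)` of `X(g,n)`. -/
def paramNumerator (g n : ℕ) : Idx g n → MvPolynomial (Idx g n) ℂ :=
  Sum.elim (fun x => MvPolynomial.X (Sum.inl x) * (genericSum g n).det)
    (fun x => (Matrix.of (fun i j => MvPolynomial.X (Sum.inr (x.1, i, j))) *
      (genericSum g n).adjugate : Matrix (Fin n) (Fin n) (MvPolynomial (Idx g n) ℂ)) x.2.1 x.2.2)

/-- The point of affine space whose coordinates are the entries of `A` and `B`. -/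
def entries {g n : ℕ} (A B : Fin g → Matrix (Fin n) (Fin n) ℂ) : Idx g n → ℂ :=
  Sum.elim (fun x => A x.1 x.2.1 x.2.2) (fun x => B x.1 x.2.1 x.2.2)

theorem exists_eq_entries {g n : ℕ} (v : Idx g n → ℂ) : ∃ A B, v = entries A B :=
  ⟨fun k i j => v (Sum.inl (k, i, j)), fun k i j => v (Sum.inr (k, i, j)), by
    ext (_ | _) <;> rfl⟩

theorem map_genericSum {g n : ℕ} (A B : Fin g → Matrix (Fin n) (Fin n) ℂ) :
    (MvPolynomial.eval (entries A B)).mapMatrix (genericSum g n) = ∑ k, A k * B k := by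
  simp only [genericSum, map_sum, _root_.map_mul]
  refine Finset.sum_congr rfl fun k _ => ?_
  congr 1 <;> ext i j <;> simp [entries]

theorem eval_det_genericSum {g n : ℕ} (A B : Fin g → Matrix (Fin n) (Fin n) ℂ) :
    MvPolynomial.eval (entries A B) (genericSum g n).det = (∑ k, A k * B k).det := by
  rw [RingHom.map_det, map_genericSum]

theorem eval_paramNumerator_div {g n : ℕ} (A B : Fin g → Matrix (Fin n) (Fin n) ℂ)
    (h : (∑ k, A k * B k).det ≠ 0) :
    (fun i => MvPolynomial.eval (entries A B) (paramNumerator g n i) /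
      MvPolynomial.eval (entries A B) (genericSum g n).det) =
    entries A (fun k => B k * (∑ l, A l * B l)⁻¹) := by
  ext (⟨k, i, j⟩ | ⟨k, i, j⟩)
  · rw [eval_det_genericSum, div_eq_iff h]
    simp only [paramNumerator, Sum.elim_inl, _root_.map_mul, eval_det_genericSum,
      MvPolynomial.eval_X]
    rfl
  · have hadj : ∀ a b, MvPolynomial.eval (entries A B) ((genericSum g n).adjugate a b) =
        (∑ l, A l * B l).adjugate a b := fun a b => by
      rw [← map_genericSum A B, ← RingHom.map_adjugate]
      rfl
    rw [eval_det_genericSum, div_eq_iff h]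
    simp only [paramNumerator, Sum.elim_inr, Matrix.mul_apply, map_sum, _root_.map_mul, hadj,
      Matrix.of_apply, MvPolynomial.eval_X]
    simp only [entries, Sum.elim_inr, Matrix.inv_def, Ring.inverse_eq_inv',
      Matrix.smul_apply, smul_eq_mul, Matrix.mul_apply, Finset.sum_mul]
    refine Finset.sum_congr rfl fun x _ => ?_
    field_simp

theorem exists_sum_mul_eq_one {g : ℕ} (n : ℕ) (hg : 0 < g) :
    ∃ A B : Fin g → Matrix (Fin n) (Fin n) ℂ, ∑ k, A k * B k = 1 :=
  ⟨Pi.single ⟨0, hg⟩ 1, fun _ => 1, by simp⟩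

/-- The pullback of `p` along the rational parametrization, with denominators cleared. -/
theorem exists_pullback {g n : ℕ} (p : MvPolynomial (Idx g n) ℂ) :
    ∃ (P : MvPolynomial (Idx g n) ℂ) (N : ℕ), ∀ A B : Fin g → Matrix (Fin n) (Fin n) ℂ,
      (∑ k, A k * B k).det ≠ 0 → MvPolynomial.eval (entries A B) P =
        (∑ k, A k * B k).det ^ N * evalAt A (fun k => B k * (∑ l, A l * B l)⁻¹) p := by
  obtain ⟨P, N, hP⟩ :=
    exists_eval_eq_pow_mul_eval_div (paramNumerator g n) (genericSum g n).det p
  refine ⟨P, N, fun A B h => ?_⟩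
  rw [hP _ (by rwa [eval_det_genericSum]), eval_paramNumerator_div A B h, eval_det_genericSum]
  rfl

theorem mem_vanishingIdeal_of_pullback_eq_zero {g n : ℕ} {p : MvPolynomial (Idx g n) ℂ} {N : ℕ}
    (h : ∀ A B : Fin g → Matrix (Fin n) (Fin n) ℂ, (∑ k, A k * B k).det ≠ 0 →
      MvPolynomial.eval (entries A B) (0 : MvPolynomial (Idx g n) ℂ) =
        (∑ k, A k * B k).det ^ N * evalAt A (fun k => B k * (∑ l, A l * B l)⁻¹) p) :
    p ∈ vanishingIdeal g n := by
  intro A B hAB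
  simpa [hAB] using (h A B (by simp [hAB])).symm

/-- **Irreducibility of `X(g,n)`:** the vanishing ideal of
`X(g,n) = {(A,B) : Σ_k A_k B_k = I_n}` is a prime ideal of the polynomial ring. -/
theorem vanishingIdeal_isPrime (g n : ℕ) (hg : 0 < g) (hn : 0 < n) :
    (vanishingIdeal g n).IsPrime := by
  obtain ⟨A₀, B₀, h₀⟩ := exists_sum_mul_eq_one n hg
  refine ⟨fun htop => ?_, fun {p q} hpq => ?_⟩
  · have h1 : (1 : MvPolynomial (Idx g n) ℂ) ∈ vanishingIdeal g n := htop ▸ Submodule.mem_top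
    simpa [evalAt] using h1 A₀ B₀ h₀
  · obtain ⟨P, N, hP⟩ := exists_pullback p
    obtain ⟨Q, M, hQ⟩ := exists_pullback q
    have hdet : (genericSum g n).det ≠ 0 := fun h => by
      simpa [h, h₀] using eval_det_genericSum A₀ B₀
    have hzero : P * Q * (genericSum g n).det = 0 := by
      refine MvPolynomial.funext fun v => ?_
      obtain ⟨A, B, rfl⟩ := exists_eq_entries v
      rw [_root_.map_mul, _root_.map_mul, eval_det_genericSum, map_zero]
      by_cases h : (∑ k, A k * B k).det = 0
      · rw [h, mul_zero]
      · have hX : ∑ k, A k * (B k * (∑ l, A l * B l)⁻¹) = 1 := by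
          simp_rw [← Matrix.mul_assoc, ← Finset.sum_mul]
          exact Matrix.mul_nonsing_inv _ (isUnit_iff_ne_zero.mpr h)
        have hv := hpq A (fun k => B k * (∑ l, A l * B l)⁻¹) hX
        rw [evalAt, _root_.map_mul] at hv
        rw [hP A B h, hQ A B h, mul_mul_mul_comm]
        simp only [evalAt, hv, mul_zero, zero_mul]
    rcases mul_eq_zero.mp ((mul_eq_zero.mp hzero).resolve_right hdet) with rfl | rfl
    · exact Or.inl (mem_vanishingIdeal_of_pullback_eq_zero hP)
    · exact Or.inr (mem_vanishingIdeal_of_pullback_eq_zero hQ)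
end
end
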